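/- Deterministic error bound (squared-sum form): under the model Y = Σ_k W*^(k) + E with rank(W*^(k)_(k)) = r̄_k, spectral incoherence ‖W*^(l)_(k)‖_{S∞} ≤ α for all l ≠ k, and regularization constant λ ≥ 2 max_k ‖E_(k)‖_{S∞} + α(K−1), any minimizer Ŵ of (1/2)‖Y − W‖_F² + λ‖W‖_{S1/1,latent} subject to ‖W^(k)_(l)‖_{S∞} ≤ α for all l ≠ k, with induced optimal decomposition Ŵ = Σ_k Ŵ^(k), satisfies Σ_{k=1}^K ‖Ŵ^(k) − W*^(k)‖_F² ≤ c λ² Σ_{k=1}^K r̄_k for a universal constant c (c = 256 suffices). -/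

import Mathlib

open scoped BigOperators

namespace TensorPaper

noncomputable def singularValues {m p : Type*} [Fintype m] [Fintype p] [DecidableEq m]
    (A : Matrix m p ℝ) : m → ℝ :=
  fun i => Real.sqrt ((Matrix.isHermitian_mul_conjTranspose_self A).eigenvalues i)

noncomputable def nuclearNorm {m p : Type*} [Fintype m] [Fintype p] [DecidableEq m]
    (A : Matrix m p ℝ) : ℝ := ∑ i, singularValues A i

noncomputable def spectralNorm {m p : Type*} [Fintype m] [Fintype p] [DecidableEq m]
    (A : Matrix m p ℝ) : ℝ := ⨆ i, singularValues A i

noncomputable def frobM {m p : Type*} [Fintype m] [Fintype p]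
    (A : Matrix m p ℝ) : ℝ := Real.sqrt (∑ i, ∑ j, A i j ^ 2)

variable {K : ℕ}

abbrev Tensor (n : Fin K → ℕ) : Type := (∀ j, Fin (n j)) → ℝ

noncomputable def unfoldT (n : Fin K → ℕ) (k : Fin K) (W : Tensor n) :
    Matrix (Fin (n k)) (∀ j : {j : Fin K // j ≠ k}, Fin (n j.1)) ℝ :=
  fun i rest => W (fun j => if h : j = k then Fin.cast (congrArg n h.symm) i else rest ⟨j, h⟩)

noncomputable def frobT (n : Fin K → ℕ) (W : Tensor n) : ℝ :=
  Real.sqrt (∑ x, W x ^ 2)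

noncomputable def tdot (n : Fin K → ℕ) (W X : Tensor n) : ℝ := ∑ x, W x * X x

noncomputable def latentNorm (n : Fin K → ℕ) (W : Tensor n) : ℝ :=
  sInf {s | ∃ Ws : Fin K → Tensor n,
    (∑ k, Ws k) = W ∧ s = ∑ k, nuclearNorm (unfoldT n k (Ws k))}

noncomputable def overlapSup (n : Fin K → ℕ) (X : Tensor n) : ℝ :=
  ⨆ k, spectralNorm (unfoldT n k X)

section Helpers

set_option linter.unusedSectionVars false

open Matrix

variable {m p : Type*} [Fintype m] [Fintype p] [DecidableEq m]

theorem sv_nonneg (A : Matrix m p ℝ) (i : m) : 0 ≤ singularValues A i := Real.sqrt_nonneg _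

theorem nuc_nonneg (A : Matrix m p ℝ) : 0 ≤ nuclearNorm A :=
  Finset.sum_nonneg fun i _ => sv_nonneg A i

theorem spec_nonneg (A : Matrix m p ℝ) : 0 ≤ spectralNorm A :=
  Real.iSup_nonneg fun i => sv_nonneg A i

theorem sv_sq (A : Matrix m p ℝ) (i : m) :
    singularValues A i ^ 2 = (Matrix.isHermitian_mul_conjTranspose_self A).eigenvalues i :=
  Real.sq_sqrt ((Matrix.posSemidef_self_mul_conjTranspose A).eigenvalues_nonneg i)

theorem exists_spec (A : Matrix m p ℝ) : ∃ V : Matrix m m ℝ, V * Vᴴ = 1 ∧ Vᴴ * V = 1 ∧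
    A * Aᴴ = V * diagonal (fun i => singularValues A i ^ 2) * Vᴴ := by
  have hA := Matrix.isHermitian_mul_conjTranspose_self A
  refine ⟨(hA.eigenvectorUnitary : Matrix m m ℝ), ?_, ?_, ?_⟩
  · exact Unitary.mul_star_self_of_mem hA.eigenvectorUnitary.2
  · exact Unitary.star_mul_self_of_mem hA.eigenvectorUnitary.2
  · conv_lhs => rw [hA.spectral_theorem, Unitary.conjStarAlgAut_apply]
    have : (fun i => singularValues A i ^ 2) = hA.eigenvalues := funext fun i => sv_sq A i
    rw [this]
    rfl

theorem trace_mul_ct (A B : Matrix m p ℝ) : (A * Bᴴ).trace = ∑ i, ∑ j, A i j * B i j := by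
  simp [Matrix.trace, Matrix.mul_apply]

theorem dual_aux (c : ℝ) (hc : 0 ≤ c) (G A : Matrix m p ℝ)
    (hG : (c ^ 2 • (1 : Matrix m m ℝ) - G * Gᴴ).PosSemidef) :
    (G * Aᴴ).trace ≤ c * nuclearNorm A := by
  obtain ⟨V, h1, h2, h3⟩ := exists_spec A
  have e1 : (G * Aᴴ).trace = ((Vᴴ * G) * (Vᴴ * A)ᴴ).trace := by
    rw [conjTranspose_mul, conjTranspose_conjTranspose]
    calc (G * Aᴴ).trace = ((G * Aᴴ) * (V * Vᴴ)).trace := by rw [h1, Matrix.mul_one]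
      _ = (Vᴴ * (G * Aᴴ * V)).trace := by rw [← Matrix.mul_assoc, Matrix.trace_mul_comm]
      _ = _ := by simp only [Matrix.mul_assoc]
  rw [e1, trace_mul_ct, nuclearNorm, Finset.mul_sum]
  refine Finset.sum_le_sum fun i _ => ?_
  have a1 : ∑ j, (Vᴴ * A) i j ^ 2 = singularValues A i ^ 2 := by
    have : ((Vᴴ * A) * (Vᴴ * A)ᴴ) = diagonal (fun i => singularValues A i ^ 2) := by
      rw [conjTranspose_mul, conjTranspose_conjTranspose]
      calc Vᴴ * A * (Aᴴ * V) = Vᴴ * (A * Aᴴ) * V := by simp only [Matrix.mul_assoc]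
        _ = (Vᴴ * V) * diagonal (fun i => singularValues A i ^ 2) * (Vᴴ * V) := by
          rw [h3]; simp only [Matrix.mul_assoc]
        _ = _ := by rw [h2]; simp
    have := congrFun (congrFun this i) i
    rw [diagonal_apply_eq] at this
    rw [← this, Matrix.mul_apply]
    simp only [conjTranspose_apply, star_trivial, sq]
  have a2 : ∑ j, (Vᴴ * G) i j ^ 2 ≤ c ^ 2 := by
    have hp := (hG.conjTranspose_mul_mul_same V).diag_nonneg (i := i)
    have : Vᴴ * (c ^ 2 • (1 : Matrix m m ℝ) - G * Gᴴ) * V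
        = c ^ 2 • (1 : Matrix m m ℝ) - (Vᴴ * G) * (Vᴴ * G)ᴴ := by
      rw [conjTranspose_mul, conjTranspose_conjTranspose, Matrix.mul_sub, Matrix.sub_mul]
      rw [Matrix.mul_smul, Matrix.smul_mul, Matrix.mul_one, h2]
      simp only [Matrix.mul_assoc]
    rw [this] at hp
    have e : ((Vᴴ * G) * (Vᴴ * G)ᴴ) i i = ∑ j, (Vᴴ * G) i j ^ 2 := by
      rw [Matrix.mul_apply]
      simp only [conjTranspose_apply, star_trivial, sq]
    rw [Matrix.sub_apply, e] at hp
    simp only [Matrix.smul_apply, Matrix.one_apply_eq, smul_eq_mul, mul_one] at hp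
    linarith
  have cs := Finset.sum_mul_sq_le_sq_mul_sq Finset.univ (fun j => (Vᴴ * G) i j)
    (fun j => (Vᴴ * A) i j)
  rw [a1] at cs
  have hs := sv_nonneg A i
  refine abs_le_of_sq_le_sq' ?_ (mul_nonneg hc hs) |>.2
  calc _ ≤ _ := cs
    _ ≤ c ^ 2 * singularValues A i ^ 2 := by gcongr
    _ = _ := by ring

theorem dual_spec (B A : Matrix m p ℝ) :
    |(B * Aᴴ).trace| ≤ spectralNorm B * nuclearNorm A := by
  have key : (spectralNorm B ^ 2 • (1 : Matrix m m ℝ) - B * Bᴴ).PosSemidef := by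
    obtain ⟨V, h1, h2, h3⟩ := exists_spec B
    have : spectralNorm B ^ 2 • (1 : Matrix m m ℝ) - B * Bᴴ =
        V * diagonal (fun i => spectralNorm B ^ 2 - singularValues B i ^ 2) * Vᴴ := by
      have e : diagonal (fun i => spectralNorm B ^ 2 - singularValues B i ^ 2)
        = spectralNorm B ^ 2 • (1 : Matrix m m ℝ)
          - diagonal (fun i => singularValues B i ^ 2) := by
        rw [smul_one_eq_diagonal, diagonal_sub]
      rw [h3, e, Matrix.mul_sub, Matrix.sub_mul]
      rw [Matrix.mul_smul, Matrix.smul_mul, Matrix.mul_one, h1]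
    rw [this]
    refine PosSemidef.mul_mul_conjTranspose_same ?_ V
    rw [posSemidef_diagonal_iff]
    intro i
    have : singularValues B i ≤ spectralNorm B :=
      le_ciSup (f := singularValues B) (Set.finite_range _).bddAbove i
    have := pow_le_pow_left₀ (sv_nonneg B i) this 2
    linarith
  rw [abs_le']
  refine ⟨dual_aux _ (spec_nonneg B) B A key, ?_⟩
  have := dual_aux _ (spec_nonneg B) (-B) A (by simpa using key)
  simpa using this

theorem dual_pi (G A : Matrix m p ℝ) (hG : G * Gᴴ * G = G) :
    (G * Aᴴ).trace ≤ nuclearNorm A := by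
  have := dual_aux 1 zero_le_one G A ?_
  · simpa using this
  · have e : (1 : ℝ) ^ 2 • (1 : Matrix m m ℝ) - G * Gᴴ = (1 - G * Gᴴ) * (1 - G * Gᴴ)ᴴ := by
      have : G * Gᴴ * (G * Gᴴ) = G * Gᴴ := by rw [← Matrix.mul_assoc, hG]
      rw [conjTranspose_sub, conjTranspose_mul, conjTranspose_conjTranspose, conjTranspose_one,
        Matrix.mul_sub, Matrix.sub_mul, Matrix.sub_mul, this]
      simp
    rw [e]
    exact posSemidef_self_mul_conjTranspose _

theorem polar (A : Matrix m p ℝ) : ∃ (U : Matrix m p ℝ) (M : Matrix m m ℝ) (N : Matrix p p ℝ),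
    U = M * A ∧ U = A * N ∧ U * Uᴴ * U = U ∧ U * Uᴴ * A = A ∧ A * (Uᴴ * U) = A ∧
    (U * Aᴴ).trace = nuclearNorm A := by
  obtain ⟨V, h1, h2, h3⟩ := exists_spec A
  set s := singularValues A with hs
  let F : (m → ℝ) → Matrix m m ℝ := fun g => V * diagonal g * Vᴴ
  have hF : ∀ g h, F g * F h = F (fun i => g i * h i) := by
    intro g h
    calc V * diagonal g * Vᴴ * (V * diagonal h * Vᴴ)
        = V * diagonal g * (Vᴴ * V) * diagonal h * Vᴴ := by simp only [Matrix.mul_assoc]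
      _ = _ := by rw [h2, Matrix.mul_one, Matrix.mul_assoc V, diagonal_mul_diagonal]
  have hFt : ∀ g, (F g)ᴴ = F g := by
    intro g
    simp [F, Matrix.mul_assoc, diagonal_conjTranspose]
  have hAA : A * Aᴴ = F (fun i => s i ^ 2) := h3
  have hFe : ∀ g, (∀ i, s i ≠ 0 → g i = 1) → F g * A = A := by
    intro g hg
    have : (F g * A - A) * (F g * A - A)ᴴ = 0 := by
      have e : F g * A - A = (F g - 1) * A := by rw [Matrix.sub_mul, Matrix.one_mul]
      have e2 : F g - 1 = F (fun i => g i - 1) := by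
        have : diagonal (fun i => g i - 1) = diagonal g - (1 : Matrix m m ℝ) := by
          rw [← diagonal_one, diagonal_sub]
        simp only [F]
        rw [this, Matrix.mul_sub, Matrix.sub_mul, Matrix.mul_one, h1]
      rw [e, conjTranspose_mul, Matrix.mul_assoc, ← Matrix.mul_assoc A, hAA, e2, hFt, hF, hF]
      have : (fun i => (g i - 1) * (s i ^ 2 * (g i - 1))) = 0 := by
        funext i
        by_cases h : s i = 0
        · simp [h]
        · simp [hg i h]
      rw [this]
      simp [F]
    exact sub_eq_zero.1 (self_mul_conjTranspose_eq_zero.1 this)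
  have hAx : ∀ g h (B : Matrix m p ℝ), F g * (A * (Aᴴ * (F h * B)))
      = F (fun i => g i * (s i ^ 2 * h i)) * B := by
    intro g h B
    rw [← Matrix.mul_assoc A, hAA, ← Matrix.mul_assoc (F _) (F h), hF, ← Matrix.mul_assoc, hF]
  have hAy : ∀ h (B : Matrix m p ℝ), (A * (Aᴴ * (F h * B)))
      = F (fun i => (s i ^ 2 * h i)) * B := by
    intro h B
    rw [← Matrix.mul_assoc A, hAA, ← Matrix.mul_assoc (F _) (F h), hF]
  refine ⟨F (fun i => (s i)⁻¹) * A, F (fun i => (s i)⁻¹), Aᴴ * (F (fun i => (s i)⁻¹ ^ 3) * A),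
    rfl, ?_, ?_, ?_, ?_, ?_⟩
  · rw [hAy]
    congr 2
    funext i
    by_cases h : s i = 0
    · simp [h]
    · field_simp
  · rw [conjTranspose_mul, hFt]
    simp only [Matrix.mul_assoc]
    rw [← Matrix.mul_assoc (F _) (F _), hF, hAx]
    congr 2
    funext i
    by_cases h : s i = 0
    · simp [h]
    · field_simp
  · rw [conjTranspose_mul, hFt]
    simp only [Matrix.mul_assoc]
    rw [hAx]
    apply hFe
    intro i h
    field_simp
  · rw [conjTranspose_mul, hFt]
    simp only [Matrix.mul_assoc]
    rw [← Matrix.mul_assoc (F _) (F _), hF, hAy]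
    apply hFe
    intro i h
    field_simp
  · rw [Matrix.mul_assoc, hAA, hF]
    simp only [F]
    rw [Matrix.mul_assoc, Matrix.trace_mul_comm, Matrix.mul_assoc, h2, Matrix.mul_one,
      trace_diagonal, nuclearNorm]
    refine Finset.sum_congr rfl fun i _ => ?_
    rw [← hs]
    by_cases h : s i = 0
    · simp [h]
    · field_simp

theorem nuc_add (A B : Matrix m p ℝ) : nuclearNorm (A + B) ≤ nuclearNorm A + nuclearNorm B := by
  obtain ⟨U, M, N, -, -, h, -, -, ht⟩ := polar (A + B)
  rw [← ht, conjTranspose_add, Matrix.mul_add, trace_add]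
  exact add_le_add (dual_pi U A h) (dual_pi U B h)

theorem nuc_neg (A : Matrix m p ℝ) : nuclearNorm (-A) = nuclearNorm A := by
  have : ∀ B : Matrix m p ℝ, nuclearNorm (-B) ≤ nuclearNorm B := by
    intro B
    obtain ⟨U, M, N, -, -, h, -, -, ht⟩ := polar (-B)
    have := dual_pi (-U) B (by simpa using h)
    rw [← ht]
    simpa using this
  refine le_antisymm (this A) ?_
  simpa using this (-A)

theorem frob_nonneg (A : Matrix m p ℝ) : 0 ≤ (A * Aᴴ).trace := by
  rw [trace_mul_ct]
  exact Finset.sum_nonneg fun i _ => Finset.sum_nonneg fun j _ => mul_self_nonneg _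

theorem nuc_le_rank (A : Matrix m p ℝ) :
    nuclearNorm A ^ 2 ≤ (A.rank : ℝ) * (A * Aᴴ).trace := by
  have hA := Matrix.isHermitian_mul_conjTranspose_self A
  have e1 : (A * Aᴴ).trace = ∑ i, singularValues A i ^ 2 := by
    rw [hA.trace_eq_sum_eigenvalues]
    exact Finset.sum_congr rfl fun i _ => (sv_sq A i).symm
  have e2 : A.rank = (Finset.univ.filter fun i => singularValues A i ≠ 0).card := by
    rw [← rank_self_mul_conjTranspose, hA.rank_eq_card_non_zero_eigs, Fintype.card_subtype]
    congr 1
    ext i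
    simp only [Finset.mem_filter, Finset.mem_univ, true_and, ← sv_sq]
    simp
  have e3 : nuclearNorm A = ∑ i ∈ Finset.univ.filter (fun i => singularValues A i ≠ 0),
      singularValues A i := by
    rw [Finset.sum_filter_ne_zero]; rfl
  rw [e1, e2, e3]
  refine sq_sum_le_card_mul_sum_sq.trans ?_
  gcongr
  simp

/-- orthogonal projections do not increase the Frobenius norm -/
theorem frob_proj (P : Matrix m m ℝ) (hP : P * P = P) (hPt : Pᴴ = P) (A : Matrix m p ℝ) :
    (A * Aᴴ).trace = ((P * A) * (P * A)ᴴ).trace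
      + (((1 - P) * A) * ((1 - P) * A)ᴴ).trace := by
  have g : ∀ R : Matrix m m ℝ, R * R = R → Rᴴ = R →
      ((R * A) * (R * A)ᴴ).trace = (R * (A * Aᴴ)).trace := by
    intro R h1 h2
    rw [conjTranspose_mul, h2, ← Matrix.mul_assoc, trace_mul_comm]
    simp only [← Matrix.mul_assoc]
    rw [h1]
  rw [g P hP hPt, g (1 - P) (by simp [Matrix.mul_sub, Matrix.sub_mul, hP])
    (by rw [conjTranspose_sub, conjTranspose_one, hPt]), Matrix.sub_mul, trace_sub]
  simp

theorem frob_ct [DecidableEq p] (A : Matrix m p ℝ) : (Aᴴ * Aᴴᴴ).trace = (A * Aᴴ).trace := by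
  rw [conjTranspose_conjTranspose, trace_mul_comm]

theorem decomp (A D : Matrix m p ℝ) :
    nuclearNorm A + nuclearNorm D ≤ nuclearNorm (A + D)
      + 4 * (Real.sqrt A.rank * Real.sqrt (D * Dᴴ).trace) := by
  classical
  obtain ⟨U, M, N, hM, hN, hU, hUA, hAU, ht⟩ := polar A
  set P := U * Uᴴ with hPdef
  set Q := Uᴴ * U with hQdef
  have hPP : P * P = P := by rw [hPdef, ← Matrix.mul_assoc, hU]
  have hPt : Pᴴ = P := by simp [hPdef]
  have hUQ : U * Q = U := by rw [hQdef, ← Matrix.mul_assoc, hU]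
  have hQQ : Q * Q = Q := by
    conv_lhs => rw [hQdef, Matrix.mul_assoc, ← hQdef, hUQ]
  have hQt : Qᴴ = Q := by simp [hQdef]
  have hQU : Q * Uᴴ = Uᴴ := by
    have := congrArg conjTranspose hUQ
    rwa [conjTranspose_mul, hQt] at this
  have hUP : Uᴴ * P = Uᴴ := by
    have := congrArg conjTranspose hU
    rwa [conjTranspose_mul, hPt] at this
  set B := (1 - P) * D * (1 - Q) with hB
  have hUB : Uᴴ * B = 0 := by
    rw [hB, ← Matrix.mul_assoc, ← Matrix.mul_assoc, Matrix.mul_sub Uᴴ, hUP]; simp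
  have hBU : B * Uᴴ = 0 := by
    rw [hB, Matrix.mul_assoc, Matrix.sub_mul _ _ Uᴴ, hQU]; simp
  have hBA : B * Aᴴ = 0 := by
    have : Q * Aᴴ = Aᴴ := by
      have := congrArg conjTranspose hAU
      rwa [conjTranspose_mul, hQt] at this
    rw [hB, Matrix.mul_assoc, Matrix.sub_mul _ _ Aᴴ, this]; simp
  have hUB' : U * Bᴴ = 0 := by
    have := congrArg conjTranspose hBU
    simpa using this
  -- pinching
  have s1 : nuclearNorm A + nuclearNorm B ≤ nuclearNorm (A + B) := by
    obtain ⟨T, M', N', hM', hN', hT, -, -, ht'⟩ := polar B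
    have t1 : T * Uᴴ = 0 := by rw [hM', Matrix.mul_assoc, hBU, Matrix.mul_zero]
    have t2 : Uᴴ * T = 0 := by rw [hN', ← Matrix.mul_assoc, hUB, Matrix.zero_mul]
    have t1' : U * Tᴴ = 0 := by
      have := congrArg conjTranspose t1
      simpa using this
    have t2' : Tᴴ * U = 0 := by
      have := congrArg conjTranspose t2
      simpa using this
    have t3 : T * Aᴴ = 0 := by rw [hM', Matrix.mul_assoc, hBA, Matrix.mul_zero]
    have hpi : (U + T) * (U + T)ᴴ * (U + T) = U + T := by
      have q : (U + T) * (U + T)ᴴ = U * Uᴴ + T * Tᴴ := by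
        rw [conjTranspose_add, Matrix.mul_add, Matrix.add_mul, Matrix.add_mul, t1, t1']
        simp
      rw [q, Matrix.mul_add, Matrix.add_mul, Matrix.add_mul, hT, ← hPdef, hU, hPdef,
        Matrix.mul_assoc U, t2, Matrix.mul_assoc T, t2']
      simp
    have := dual_pi (U + T) (A + B) hpi
    rw [conjTranspose_add, Matrix.mul_add, Matrix.add_mul, Matrix.add_mul, t3, hUB', add_zero,
      zero_add, trace_add, ht, ht'] at this
    exact this
  have hUr : U.rank ≤ A.rank := by rw [hM]; exact rank_mul_le_right _ _
  have hfD := frob_nonneg D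
  have low : ∀ C : Matrix m p ℝ, C.rank ≤ A.rank → (C * Cᴴ).trace ≤ (D * Dᴴ).trace →
      nuclearNorm C ≤ Real.sqrt A.rank * Real.sqrt (D * Dᴴ).trace := by
    intro C h1 h2
    rw [← Real.sqrt_mul (Nat.cast_nonneg _)]
    refine Real.le_sqrt_of_sq_le ((nuc_le_rank C).trans ?_)
    have : (C.rank : ℝ) ≤ A.rank := by exact_mod_cast h1
    have := frob_nonneg C
    gcongr
  have l1 : nuclearNorm (P * D) ≤ Real.sqrt A.rank * Real.sqrt (D * Dᴴ).trace := by
    refine low _ ?_ ?_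
    · refine (rank_mul_le_left _ _).trans ?_
      rw [hPdef, rank_self_mul_conjTranspose]; exact hUr
    · rw [frob_proj P hPP hPt D]
      linarith [frob_nonneg ((1 - P) * D)]
  have l2 : nuclearNorm ((1 - P) * D * Q) ≤ Real.sqrt A.rank * Real.sqrt (D * Dᴴ).trace := by
    refine low _ ?_ ?_
    · refine (rank_mul_le_right _ _).trans ?_
      rw [hQdef, rank_conjTranspose_mul_self]; exact hUr
    · rw [frob_proj P hPP hPt D]
      generalize (1 - P) * D = X
      have a := frob_proj Q hQQ hQt Xᴴ
      rw [frob_ct] at a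
      have b : Q * Xᴴ = (X * Q)ᴴ := by rw [conjTranspose_mul, hQt]
      rw [b, frob_ct] at a
      linarith [frob_nonneg (P * D), frob_nonneg ((1 - Q) * Xᴴ)]
  have eD : D = B + (P * D + (1 - P) * D * Q) := by
    rw [hB]
    simp only [Matrix.mul_sub, Matrix.sub_mul, Matrix.mul_one, Matrix.one_mul]
    abel
  have l3 := nuc_add (P * D) ((1 - P) * D * Q)
  set R := P * D + (1 - P) * D * Q
  have l4 : nuclearNorm D ≤ nuclearNorm B + nuclearNorm R := by
    conv_lhs => rw [eD]
    exact nuc_add _ _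
  have l5 : nuclearNorm (A + B) ≤ nuclearNorm (A + D) + nuclearNorm R := by
    have : A + B = (A + D) + (-R) := by
      conv_rhs => rw [eD]
      abel
    rw [this, ← nuc_neg R]
    exact nuc_add _ _
  linarith

end Helpers

section TensorHelpers

open Matrix

theorem tdot_unfold {K : ℕ} (n : Fin K → ℕ) (k : Fin K) (W X : Tensor n) :
    (unfoldT n k W * (unfoldT n k X)ᴴ).trace = tdot n W X := by
  rw [trace_mul_ct, tdot, ← Fintype.sum_prod_type', ← (Equiv.piSplitAt k (fun j => Fin (n j))).symm.sum_comp]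
  refine Finset.sum_congr rfl fun x _ => ?_
  have : (Equiv.piSplitAt k (fun j => Fin (n j))).symm x
      = (fun j => if h : j = k then Fin.cast (congrArg n h.symm) x.1 else x.2 ⟨j, h⟩) := by
    funext j
    by_cases h : j = k
    · subst h; simp [Equiv.piSplitAt]
    · simp [Equiv.piSplitAt, h]
  rw [this]
  rfl

theorem frobT_sq {K : ℕ} (n : Fin K → ℕ) (W : Tensor n) : frobT n W ^ 2 = tdot n W W := by
  rw [frobT, Real.sq_sqrt (Finset.sum_nonneg fun _ _ => sq_nonneg _), tdot]
  exact Finset.sum_congr rfl fun _ _ => sq _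

theorem tdot_comm {K : ℕ} (n : Fin K → ℕ) (W X : Tensor n) : tdot n W X = tdot n X W :=
  Finset.sum_congr rfl fun _ _ => mul_comm _ _

theorem tdot_sub {K : ℕ} (n : Fin K → ℕ) (W X Y : Tensor n) :
    tdot n (W - X) Y = tdot n W Y - tdot n X Y := by
  simp [tdot, sub_mul]

theorem tdot_sum {K : ℕ} {ι : Type*} (s : Finset ι) (n : Fin K → ℕ) (W : ι → Tensor n)
    (Y : Tensor n) : tdot n Y (∑ k ∈ s, W k) = ∑ k ∈ s, tdot n Y (W k) := by
  simp only [tdot, Finset.sum_apply, Finset.mul_sum]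
  exact Finset.sum_comm

theorem tdot_le {K : ℕ} (n : Fin K → ℕ) (k : Fin K) (W X : Tensor n) :
    |tdot n W X| ≤ spectralNorm (unfoldT n k W) * nuclearNorm (unfoldT n k X) := by
  rw [← tdot_unfold n k]
  exact dual_spec _ _

theorem decompT {K : ℕ} (n : Fin K → ℕ) (k : Fin K) (W X : Tensor n) :
    nuclearNorm (unfoldT n k W) + nuclearNorm (unfoldT n k (X - W)) ≤ nuclearNorm (unfoldT n k X)
      + 4 * (Real.sqrt (unfoldT n k W).rank * frobT n (X - W)) := by
  have := decomp (unfoldT n k W) (unfoldT n k (X - W))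
  rw [tdot_unfold, ← frobT_sq, Real.sqrt_sq (show 0 ≤ frobT n (X - W) from Real.sqrt_nonneg _)] at this
  have e : unfoldT n k W + unfoldT n k (X - W) = unfoldT n k X := by
    ext i j
    simp [unfoldT]
  rwa [e] at this

end TensorHelpers

/-- Deterministic error bound (Theorem 2). The estimator is formulated over
component tuples: `Whats` minimizes
`(1/2)‖Y − Σ_k W^(k)‖_F² + λ Σ_k ‖W^(k)_(k)‖_{S1}` over all tuples satisfying the
spectral-norm constraints `‖W^(k)_(l)‖_{S∞} ≤ α` for `l ≠ k`; this realizes the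
latent-Schatten-norm minimization together with its induced optimal decomposition. -/
theorem deterministic_error_bound {K : ℕ} (n : Fin K → ℕ)
    (Wstar : Fin K → Tensor n) (E : Tensor n) (α lam : ℝ) (hα : 0 ≤ α)
    (hinc : ∀ k l : Fin K, l ≠ k → spectralNorm (unfoldT n k (Wstar l)) ≤ α)
    (hlam : 2 * (⨆ k, spectralNorm (unfoldT n k E)) + α * ((K : ℝ) - 1) ≤ lam)
    (Whats : Fin K → Tensor n)
    (hfeas : ∀ k l : Fin K, l ≠ k → spectralNorm (unfoldT n l (Whats k)) ≤ α)
    (hmin : ∀ Ws : Fin K → Tensor n,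
      (∀ k l : Fin K, l ≠ k → spectralNorm (unfoldT n l (Ws k)) ≤ α) →
      (1 / 2) * frobT n (((∑ k, Wstar k) + E) - ∑ k, Whats k) ^ 2 +
          lam * ∑ k, nuclearNorm (unfoldT n k (Whats k)) ≤
        (1 / 2) * frobT n (((∑ k, Wstar k) + E) - ∑ k, Ws k) ^ 2 +
          lam * ∑ k, nuclearNorm (unfoldT n k (Ws k))) :
    ∑ k, frobT n (Whats k - Wstar k) ^ 2 ≤
      256 * lam ^ 2 * ∑ k, ((unfoldT n k (Wstar k)).rank : ℝ) := by
  classical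
  rcases Nat.eq_zero_or_pos K with hK | hK
  · subst hK; simp
  set e := ⨆ k, spectralNorm (unfoldT n k E) with he
  have he0 : 0 ≤ e := Real.iSup_nonneg fun k => spec_nonneg _
  have hK1 : (0 : ℝ) ≤ (K : ℝ) - 1 := by
    have : (1 : ℝ) ≤ K := by exact_mod_cast hK
    linarith
  have hβ : 0 ≤ α * ((K : ℝ) - 1) := mul_nonneg hα hK1
  have hl0 : 0 ≤ lam := by linarith
  set Δ : Fin K → Tensor n := fun k => Whats k - Wstar k with hΔ
  set ν : Fin K → ℝ := fun k => nuclearNorm (unfoldT n k (Δ k)) with hν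
  have hν0 : ∀ k, 0 ≤ ν k := fun k => nuc_nonneg _
  set r : Fin K → ℝ := fun k => ((unfoldT n k (Wstar k)).rank : ℝ) with hr
  set f : Fin K → ℝ := fun k => frobT n (Δ k) with hf
  have hbasic := hmin Wstar (fun k l hlk => hinc l k hlk.symm)
  have e1 : ((∑ k, Wstar k) + E) - ∑ k, Whats k = E - ∑ k, Δ k := by
    simp only [hΔ, Finset.sum_sub_distrib]; abel
  have e2 : ((∑ k, Wstar k) + E) - ∑ k, Wstar k = E := by abel
  rw [e1, e2, frobT_sq, frobT_sq] at hbasic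
  set Z := ∑ k, Δ k with hZ
  have e3 : tdot n (E - Z) (E - Z) = tdot n E E - 2 * tdot n E Z + tdot n Z Z := by
    rw [tdot_sub, tdot_comm n E, tdot_comm n Z, tdot_sub, tdot_sub, tdot_comm n Z E]; ring
  rw [e3] at hbasic
  have h1 : tdot n E Z ≤ e * ∑ k, ν k := by
    rw [hZ, tdot_sum, Finset.mul_sum]
    refine Finset.sum_le_sum fun k _ => (le_abs_self _).trans ((tdot_le n k _ _).trans ?_)
    refine mul_le_mul_of_nonneg_right ?_ (hν0 k)
    exact le_ciSup (f := fun k => spectralNorm (unfoldT n k E)) (Set.finite_range _).bddAbove k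
  have hcross : ∀ k l : Fin K, l ≠ k → -(2 * α * ν k) ≤ tdot n (Δ k) (Δ l) := by
    intro k l hlk
    have a : tdot n (Δ k) (Δ l) = tdot n (Whats l) (Δ k) - tdot n (Wstar l) (Δ k) := by
      rw [tdot_comm, ← tdot_sub]
    have b := abs_le.1 (tdot_le n k (Whats l) (Δ k))
    have c := abs_le.1 (tdot_le n k (Wstar l) (Δ k))
    have b' := mul_le_mul_of_nonneg_right (hfeas l k hlk.symm) (hν0 k)
    have c' := mul_le_mul_of_nonneg_right (hinc k l hlk) (hν0 k)
    simp only [hν] at b' c' ⊢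
    linarith [b.1, c.2]
  have h2 : ∑ k, f k ^ 2 ≤ tdot n Z Z + 2 * (α * ((K : ℝ) - 1)) * ∑ k, ν k := by
    have : tdot n Z Z = ∑ k, ∑ l, tdot n (Δ k) (Δ l) := by
      conv_lhs => rw [hZ, tdot_sum]
      refine Finset.sum_congr rfl fun k _ => ?_
      rw [tdot_comm, tdot_sum]
    rw [this, Finset.mul_sum, ← Finset.sum_add_distrib]
    refine Finset.sum_le_sum fun k _ => ?_
    rw [← Finset.add_sum_erase _ _ (Finset.mem_univ k)]
    have g : ∑ l ∈ Finset.univ.erase k, (-(2 * α * ν k)) ≤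
        ∑ l ∈ Finset.univ.erase k, tdot n (Δ k) (Δ l) :=
      Finset.sum_le_sum fun l hl => hcross k l (Finset.ne_of_mem_erase hl)
    rw [Finset.sum_const, Finset.card_erase_of_mem (Finset.mem_univ k), Finset.card_univ,
      Fintype.card_fin, nsmul_eq_mul, Nat.cast_sub hK, Nat.cast_one] at g
    have : f k ^ 2 = tdot n (Δ k) (Δ k) := frobT_sq n _
    rw [this]
    linarith
  have h3 : ∑ k, nuclearNorm (unfoldT n k (Wstar k)) + ∑ k, ν k ≤
      ∑ k, nuclearNorm (unfoldT n k (Whats k)) + 4 * ∑ k, Real.sqrt (r k) * f k := by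
    rw [Finset.mul_sum, ← Finset.sum_add_distrib, ← Finset.sum_add_distrib]
    exact Finset.sum_le_sum fun k _ => decompT n k (Wstar k) (Whats k)
  have hN0 : 0 ≤ ∑ k, ν k := Finset.sum_nonneg fun k _ => hν0 k
  have h4 := mul_le_mul_of_nonneg_left h3 hl0
  have h5 : (e + α * ((K : ℝ) - 1)) * ∑ k, ν k ≤ lam * ∑ k, ν k :=
    mul_le_mul_of_nonneg_right (by linarith) hN0
  have h6 : ∑ k, f k ^ 2 ≤ 8 * lam * ∑ k, Real.sqrt (r k) * f k := by
    linarith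
  have h7 : (∑ k, Real.sqrt (r k) * f k) ^ 2 ≤ (∑ k, r k) * ∑ k, f k ^ 2 := by
    have := Finset.sum_mul_sq_le_sq_mul_sq Finset.univ (fun k => Real.sqrt (r k)) f
    have g : ∀ k, Real.sqrt (r k) ^ 2 = r k := fun k => Real.sq_sqrt (Nat.cast_nonneg _)
    simpa only [g] using this
  have hS0 : 0 ≤ ∑ k, f k ^ 2 := Finset.sum_nonneg fun k _ => sq_nonneg _
  have hR0 : 0 ≤ ∑ k, r k := Finset.sum_nonneg fun k _ => Nat.cast_nonneg _
  change ∑ k, f k ^ 2 ≤ 256 * lam ^ 2 * ∑ k, r k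
  generalize ∑ k, f k ^ 2 = S at *
  generalize ∑ k, r k = R at *
  generalize ∑ k, Real.sqrt (r k) * f k = T at *
  have h8 : S ^ 2 ≤ (64 * lam ^ 2 * R) * S := by
    calc S ^ 2 ≤ (8 * lam * T) ^ 2 := pow_le_pow_left₀ hS0 h6 2
      _ = 64 * lam ^ 2 * T ^ 2 := by ring
      _ ≤ 64 * lam ^ 2 * (R * S) := by gcongr
      _ = _ := by ring
  have h9 : 0 ≤ lam ^ 2 * R := by positivity
  rcases hS0.eq_or_lt with h | h
  · rw [← h]; linarith
  · have : S ≤ 64 * lam ^ 2 * R := by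
      rw [sq] at h8
      exact le_of_mul_le_mul_right h8 h
    linarith

end TensorPaper
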